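/- Fix δ₀ ∈ (0,1). Then there exist v₀ and A₀ > 0 such that for any finite sets Λ' ⊂ Λ ⊂ ℤ^d with |Λ| ≥ v₀ and |Λ'|/|Λ| ≤ δ₀, and any N ∈ ℕ∖{0}, one has ν_Λ^N[η_{Λ'} = σ_{Λ'}] ≤ A₀ μ_{N/|Λ|}[η_{Λ'} = σ_{Λ'}] for every configuration σ_{Λ'} ∈ ℕ^{Λ'} (here η_{Λ'} denotes the restriction of η to Λ'). -/

import Mathlib

open scoped BigOperators

noncomputable section

/-- `cfact c k = c(k)! = c(1)⋯c(k)`, with `cfact c 0 = 1`. -/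
def cfact (c : ℕ → ℝ) : ℕ → ℝ
  | 0 => 1
  | k + 1 => cfact c k * c (k + 1)

/-- The configuration obtained from `η` by moving one particle from `x` to `y` (`x ≠ y`),
i.e. `η - δ^x + δ^y`. -/
def moved (d : ℕ) (η : (Fin d → ℤ) → ℕ) (x y : Fin d → ℤ) : (Fin d → ℤ) → ℕ :=
  fun z => if z = x then η x - 1 else if z = y then η y + 1 else η z

/-- Unnormalized weight of the canonical measure `ν_Λ^N` on configurations supported in
`Λ ⊂ ℤ^d` with `N` particles: `∏_{x∈Λ} 1/c(η_x)!`. -/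
def nuWd (d : ℕ) (c : ℕ → ℝ) (Λ : Finset (Fin d → ℤ)) (N : ℕ) : ((Fin d → ℤ) → ℕ) → ℝ :=
  Set.indicator {η : (Fin d → ℤ) → ℕ | (∀ x, x ∉ Λ → η x = 0) ∧ (∑ x ∈ Λ, η x) = N}
    (fun η => ∏ x ∈ Λ, (cfact c (η x))⁻¹)

/-- Expectation with respect to the probability measure obtained by normalizing the
nonnegative weight `w`. -/
def wEd (d : ℕ) (w f : ((Fin d → ℤ) → ℕ) → ℝ) : ℝ :=
  (∑' η : (Fin d → ℤ) → ℕ, w η * f η) / (∑' η : (Fin d → ℤ) → ℕ, w η)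

/-- Entropy `Ent_μ(f) = μ[f log f] - μ[f] log μ[f]` (note `Real.log 0 = 0`, giving the
convention `0 log 0 = 0`). -/
def wEntd (d : ℕ) (w f : ((Fin d → ℤ) → ℕ) → ℝ) : ℝ :=
  wEd d w (fun η => f η * Real.log (f η)) - wEd d w f * Real.log (wEd d w f)

/-- Dirichlet form of the zero-range process on `Λ ⊂ ℤ^d`:
`E(f,g) = (1/2) Σ_{x∈Λ} Σ_{y∈Λ, |x-y|=1} μ[c(η_x) ∂_{xy}f ∂_{xy}g]`. -/
def wDird (d : ℕ) (c : ℕ → ℝ) (Λ : Finset (Fin d → ℤ))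
    (w f g : ((Fin d → ℤ) → ℕ) → ℝ) : ℝ :=
  wEd d w (fun η => (1 / 2) * ∑ x ∈ Λ, ∑ y ∈ Λ,
    if (∑ i, (x i - y i).natAbs) = 1 then
      c (η x) * ((f (moved d η x y) - f η) * (g (moved d η x y) - g η)) else 0)

/-- Grand canonical partition function `Z(α) = Σ_k α^k / c(k)!`. -/
def Zfun (c : ℕ → ℝ) (α : ℝ) : ℝ := ∑' k : ℕ, α ^ k / cfact c k

/-- Mean particle number per site under the grand canonical measure with fugacity `α`. -/
def meanGC (c : ℕ → ℝ) (α : ℝ) : ℝ :=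
  (∑' k : ℕ, (k : ℝ) * α ^ k / cfact c k) / Zfun c α

/-- Cauchy product of two sequences. -/
def cv (p q : ℕ → ℝ) (k : ℕ) : ℝ := ∑ ij ∈ Finset.HasAntidiagonal.antidiagonal k, p ij.1 * q ij.2

/-- Backward ratio `p(k-1)/p(k)`. -/
def rr (p : ℕ → ℝ) : ℕ → ℝ
  | 0 => 0
  | k + 1 => p k / p (k + 1)

/-- The semiconvexity property of `log p`. -/
def SC (p : ℕ → ℝ) (ε : ℝ) : Prop := ∀ k, rr p (k + 1) ≤ rr p k + ε

lemma cv_pos {p q : ℕ → ℝ} (hp : ∀ k, 0 < p k) (hq : ∀ k, 0 < q k) (k : ℕ) : 0 < cv p q k := by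
  unfold cv
  apply Finset.sum_pos
  · intro i _
    exact mul_pos (hp _) (hq _)
  · exact ⟨(0, k), by simp⟩

lemma rr_mul_succ {p : ℕ → ℝ} (hp : ∀ k, 0 < p k) (k : ℕ) : p (k + 1) * rr p (k + 1) = p k := by
  have := (hp (k + 1)).ne'
  simp only [rr]
  field_simp

lemma sum_rr_left {p : ℕ → ℝ} (hp : ∀ k, 0 < p k) (G : ℕ → ℕ → ℝ) (k : ℕ) :
    ∑ ij ∈ Finset.HasAntidiagonal.antidiagonal (k + 1), p ij.1 * rr p ij.1 * G ij.1 ij.2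
      = ∑ ij ∈ Finset.HasAntidiagonal.antidiagonal k, p ij.1 * G (ij.1 + 1) ij.2 := by
  rw [Finset.Nat.sum_antidiagonal_succ]
  simp only [rr_mul_succ hp]
  simp [rr]

lemma sum_rr_right {p : ℕ → ℝ} (hp : ∀ k, 0 < p k) (G : ℕ → ℕ → ℝ) (k : ℕ) :
    ∑ ij ∈ Finset.HasAntidiagonal.antidiagonal (k + 1), p ij.2 * rr p ij.2 * G ij.1 ij.2
      = ∑ ij ∈ Finset.HasAntidiagonal.antidiagonal k, p ij.2 * G ij.1 (ij.2 + 1) := by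
  rw [Finset.Nat.sum_antidiagonal_succ']
  simp only [rr_mul_succ hp]
  simp [rr]

lemma sum_l {p q : ℕ → ℝ} (hp : ∀ k, 0 < p k) (hq : ∀ k, 0 < q k) (k : ℕ) :
    ∑ ij ∈ Finset.HasAntidiagonal.antidiagonal k, p ij.1 * rr p ij.1 * q ij.2 = cv p q k * rr (cv p q) k := by
  cases k with
  | zero => simp [rr]
  | succ k =>
    rw [rr_mul_succ (cv_pos hp hq), sum_rr_left hp (fun _ j => q j)]
    rfl

lemma sum_r {p q : ℕ → ℝ} (hp : ∀ k, 0 < p k) (hq : ∀ k, 0 < q k) (k : ℕ) :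
    ∑ ij ∈ Finset.HasAntidiagonal.antidiagonal k, q ij.2 * rr q ij.2 * p ij.1 = cv p q k * rr (cv p q) k := by
  cases k with
  | zero => simp [rr]
  | succ k =>
    rw [rr_mul_succ (cv_pos hp hq), sum_rr_right hq (fun i _ => p i)]
    unfold cv
    exact Finset.sum_congr rfl (fun _ _ => mul_comm _ _)

lemma SC_cv {p q : ℕ → ℝ} (hp : ∀ k, 0 < p k) (hq : ∀ k, 0 < q k) {e₁ e₂ : ℝ}
    (h1 : SC p e₁) (h2 : SC q e₂) (θ : ℝ) :
    SC (cv p q) (θ ^ 2 * e₁ + (1 - θ) ^ 2 * e₂) := by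
  intro k
  set C := cv p q with hC
  have hCpos : ∀ k, 0 < C k := cv_pos hp hq
  set l := rr C (k + 1) with hl
  have hlC : C (k + 1) * l = C k := rr_mul_succ hCpos k
  have S1 := sum_l hp hq (k + 1)
  have S2 := sum_r hp hq (k + 1)
  rw [← hC, ← hl, hlC] at S1 S2
  have S12 : ∑ ij ∈ Finset.HasAntidiagonal.antidiagonal (k + 1), p ij.1 * rr p ij.1 * (q ij.2 * rr q ij.2)
      = C k * rr C k := by
    rw [sum_rr_left hp (fun _ j => q j * rr q j), ← sum_r hp hq k]
    exact Finset.sum_congr rfl (fun _ _ => mul_comm _ _)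
  have S11 : ∑ ij ∈ Finset.HasAntidiagonal.antidiagonal (k + 1), p ij.1 * rr p ij.1 * (rr p ij.1 * q ij.2)
      ≤ C k * rr C k + e₁ * C k := by
    rw [sum_rr_left hp (fun i j => rr p i * q j), ← sum_l hp hq k, hC]
    unfold cv
    rw [Finset.mul_sum, ← Finset.sum_add_distrib]
    apply Finset.sum_le_sum
    intro ij _
    have := mul_le_mul_of_nonneg_left (h1 ij.1) (mul_pos (hp ij.1) (hq ij.2)).le
    linarith
  have S22 : ∑ ij ∈ Finset.HasAntidiagonal.antidiagonal (k + 1), q ij.2 * rr q ij.2 * (rr q ij.2 * p ij.1)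
      ≤ C k * rr C k + e₂ * C k := by
    rw [sum_rr_right hq (fun i j => rr q j * p i), ← sum_r hp hq k, hC]
    unfold cv
    rw [Finset.mul_sum, ← Finset.sum_add_distrib]
    apply Finset.sum_le_sum
    intro ij _
    have := mul_le_mul_of_nonneg_left (h2 ij.2) (mul_pos (hp ij.1) (hq ij.2)).le
    linarith
  have key : 0 ≤ ∑ ij ∈ Finset.HasAntidiagonal.antidiagonal (k + 1), p ij.1 * q ij.2 *
      (θ * rr p ij.1 + (1 - θ) * rr q ij.2 - l) ^ 2 :=
    Finset.sum_nonneg (fun ij _ => mul_nonneg (mul_pos (hp _) (hq _)).le (sq_nonneg _))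
  have expand : ∑ ij ∈ Finset.HasAntidiagonal.antidiagonal (k + 1), p ij.1 * q ij.2 *
      (θ * rr p ij.1 + (1 - θ) * rr q ij.2 - l) ^ 2
      = θ ^ 2 * (∑ ij ∈ Finset.HasAntidiagonal.antidiagonal (k + 1), p ij.1 * rr p ij.1 * (rr p ij.1 * q ij.2))
      + (1 - θ) ^ 2 *
        (∑ ij ∈ Finset.HasAntidiagonal.antidiagonal (k + 1), q ij.2 * rr q ij.2 * (rr q ij.2 * p ij.1))
      + 2 * θ * (1 - θ) *
        (∑ ij ∈ Finset.HasAntidiagonal.antidiagonal (k + 1), p ij.1 * rr p ij.1 * (q ij.2 * rr q ij.2))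
      - 2 * l * θ * (∑ ij ∈ Finset.HasAntidiagonal.antidiagonal (k + 1), p ij.1 * rr p ij.1 * q ij.2)
      - 2 * l * (1 - θ) * (∑ ij ∈ Finset.HasAntidiagonal.antidiagonal (k + 1), q ij.2 * rr q ij.2 * p ij.1)
      + l ^ 2 * C (k + 1) := by
    rw [hC]
    unfold cv
    simp only [Finset.mul_sum, ← Finset.sum_add_distrib, ← Finset.sum_sub_distrib]
    apply Finset.sum_congr rfl
    intro ij _
    ring
  rw [expand, S12, S1, S2] at key
  have T1 := mul_le_mul_of_nonneg_left S11 (sq_nonneg θ)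
  have T2 := mul_le_mul_of_nonneg_left S22 (sq_nonneg (1 - θ))
  have hfin : 0 ≤ C k * (rr C k + (θ ^ 2 * e₁ + (1 - θ) ^ 2 * e₂) - l) := by
    have : l ^ 2 * C (k + 1) = l * C k := by rw [← hlC]; ring
    rw [this] at key
    nlinarith
  have := nonneg_of_mul_nonneg_right hfin (hCpos k)
  linarith

/-- `pw w n` is the `(n+1)`-fold convolution power of `w`. -/
def pw (w : ℕ → ℝ) : ℕ → ℕ → ℝ
  | 0 => w
  | n + 1 => cv (pw w n) w

lemma pw_pos {w : ℕ → ℝ} (hw : ∀ k, 0 < w k) (n k : ℕ) : 0 < pw w n k := by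
  induction n generalizing k with
  | zero => exact hw k
  | succ n ih => exact cv_pos ih hw k

lemma SC_pw {w : ℕ → ℝ} (hw : ∀ k, 0 < w k) {e : ℝ} (h : SC w e) (n : ℕ) :
    SC (pw w n) (e / (n + 1)) := by
  induction n with
  | zero => simpa [pw] using h
  | succ n ih =>
    have := SC_cv (pw_pos hw n) hw ih h (((n : ℝ) + 1) / (n + 2))
    have e2 : ((n : ℝ) + 1 + 1) ≠ 0 := by positivity
    have e1 : ((n : ℝ) + 1) ≠ 0 := by positivity
    have e3 : ((n : ℝ) + 2) ≠ 0 := by positivity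
    have e4 : (((n : ℝ) + 1) / (n + 2)) ^ 2 * (e / (n + 1)) +
        (1 - ((n : ℝ) + 1) / (n + 2)) ^ 2 * e = e / (((n + 1 : ℕ) : ℝ) + 1) := by
      push_cast
      field_simp
      ring
    rw [e4] at this
    exact this

lemma pw_coeff (w : ℕ → ℝ) (n k : ℕ) :
    pw w n k = PowerSeries.coeff k ((PowerSeries.mk w) ^ (n + 1)) := by
  induction n generalizing k with
  | zero => simp [pw]
  | succ n ih =>
    rw [pow_succ, PowerSeries.coeff_mul]
    simp only [pw, cv, ih, PowerSeries.coeff_mk]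

lemma pw_zero (w : ℕ → ℝ) (n : ℕ) : pw w n 0 = w 0 ^ (n + 1) := by
  induction n with
  | zero => simp [pw]
  | succ n ih => simp [pw, cv, ih, pow_succ]

/-- mass one, mean `A`, variance `V`. -/
def Mom (p : ℕ → ℝ) (A V : ℝ) : Prop :=
  HasSum p 1 ∧ HasSum (fun k : ℕ => ((k : ℝ) - A) * p k) 0 ∧
    HasSum (fun k : ℕ => ((k : ℝ) - A) ^ 2 * p k) V

lemma hasSum_cv {f g : ℕ → ℝ} {F G : ℝ} (hf : HasSum f F) (hg : HasSum g G) :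
    HasSum (cv f g) (F * G) := by
  have hf' := hf.summable.norm
  have hg' := hg.summable.norm
  rw [← hf.tsum_eq, ← hg.tsum_eq, tsum_mul_tsum_eq_tsum_sum_antidiagonal_of_summable_norm hf' hg']
  exact (summable_norm_sum_mul_antidiagonal_of_summable_norm hf' hg').of_norm.hasSum

lemma Mom_cv {p q : ℕ → ℝ} {A B V W : ℝ} (hp : Mom p A V) (hq : Mom q B W) :
    Mom (cv p q) (A + B) (V + W) := by
  obtain ⟨p0, p1, p2⟩ := hp
  obtain ⟨q0, q1, q2⟩ := hq
  refine ⟨by simpa using hasSum_cv p0 q0, ?_, ?_⟩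
  · have := (hasSum_cv p1 q0).add (hasSum_cv p0 q1)
    convert this using 1
    · funext k
      unfold cv
      rw [Finset.mul_sum, ← Finset.sum_add_distrib]
      apply Finset.sum_congr rfl
      rintro ⟨i, j⟩ hij
      have : i + j = k := by simpa using hij
      subst this
      push_cast
      ring
    · ring
  · have := ((hasSum_cv p2 q0).add (hasSum_cv p0 q2)).add ((hasSum_cv p1 q1).mul_left 2)
    convert this using 1
    · funext k
      unfold cv
      rw [Finset.mul_sum, Finset.mul_sum, ← Finset.sum_add_distrib, ← Finset.sum_add_distrib]
      apply Finset.sum_congr rfl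
      rintro ⟨i, j⟩ hij
      have : i + j = k := by simpa using hij
      subst this
      push_cast
      ring
    · ring

lemma Mom_pw {w : ℕ → ℝ} {A V : ℝ} (h : Mom w A V) (n : ℕ) :
    Mom (pw w n) ((n + 1) * A) ((n + 1) * V) := by
  induction n with
  | zero => simpa [pw] using h
  | succ n ih =>
    have := Mom_cv ih h
    have e1 : ((n : ℝ) + 1) * A + A = (((n + 1 : ℕ) : ℝ) + 1) * A := by push_cast; ring
    have e2 : ((n : ℝ) + 1) * V + V = (((n + 1 : ℕ) : ℝ) + 1) * V := by push_cast; ring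
    rw [e1, e2] at this
    exact this

lemma up_bound {p : ℕ → ℝ} (hp : ∀ k, 0 < p k) {e : ℝ} (h : SC p e) {k : ℕ}
    (hk : rr p k ≤ 1) (s : ℕ) : p k * Real.exp (-e * (s : ℝ) ^ 2) ≤ p (k + s) := by
  have he : ∀ j : ℕ, rr p (k + j) ≤ 1 + j * e := by
    intro j
    induction j with
    | zero => simpa using hk
    | succ j ih =>
      have := h (k + j)
      push_cast
      rw [← add_assoc]
      linarith
  have hr : 0 ≤ e := by
    by_contra hne
    push Not at hne
    obtain ⟨j, hj⟩ := exists_nat_gt (1 / (-e))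
    rw [div_lt_iff₀ (by linarith)] at hj
    have h1 := he (j + 1)
    have h2 : 0 < rr p (k + (j + 1)) := div_pos (hp _) (hp _)
    push_cast at h1
    nlinarith
  induction s with
  | zero => simp
  | succ s ih =>
    have h1 := he (s + 1)
    have h2 := rr_mul_succ hp (k + s)
    rw [← add_assoc] at h1
    have h3 : rr p (k + s + 1) ≤ Real.exp ((s + 1 : ℝ) * e) := by
      have := Real.add_one_le_exp ((s + 1 : ℝ) * e)
      push_cast at h1
      linarith
    have h4 : p (k + s) ≤ p (k + s + 1) * Real.exp ((s + 1 : ℝ) * e) := by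
      rw [← h2]
      exact mul_le_mul_of_nonneg_left h3 (hp _).le
    have h5 : Real.exp (-e * ((s + 1 : ℕ) : ℝ) ^ 2) * Real.exp ((s + 1 : ℝ) * e)
        ≤ Real.exp (-e * (s : ℝ) ^ 2) := by
      rw [← Real.exp_add]
      apply Real.exp_le_exp.mpr
      push_cast
      have : 0 ≤ e * s := by positivity
      nlinarith
    have h6 : p k * (Real.exp (-e * ((s + 1 : ℕ) : ℝ) ^ 2) * Real.exp ((s + 1 : ℝ) * e))
        ≤ p (k + s + 1) * Real.exp ((s + 1 : ℝ) * e) :=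
      (mul_le_mul_of_nonneg_left h5 (hp k).le).trans (ih.trans h4)
    rw [← mul_assoc] at h6
    exact le_of_mul_le_mul_right h6 (Real.exp_pos _)

lemma SC_nonneg {p : ℕ → ℝ} (hp : ∀ k, 0 < p k) {e : ℝ} (h : SC p e) : 0 < e := by
  have h1 := h 0
  have h2 : 0 < rr p (0 + 1) := div_pos (hp _) (hp _)
  have h3 : rr p 0 = 0 := rfl
  linarith

lemma down_bound {p : ℕ → ℝ} (hp : ∀ k, 0 < p k) {e : ℝ} (h : SC p e) {k : ℕ}
    (hk : 1 ≤ rr p (k + 1)) (s : ℕ) : ∀ i, i + s = k → e * s ≤ 1 / 2 →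
      p k * Real.exp (-(2 * e) * (s : ℝ) ^ 2) ≤ p i := by
  have he := SC_nonneg hp h
  have hr : ∀ j i : ℕ, i + j = k + 1 → 1 - j * e ≤ rr p i := by
    intro j
    induction j with
    | zero => intro i hi; simp at hi; subst hi; simpa using hk
    | succ j ih =>
      intro i hi
      have h1 := ih (i + 1) (by omega)
      have h2 := h i
      push_cast
      linarith
  induction s with
  | zero => intro i hi _; simp at hi; subst hi; simp
  | succ s ih =>
    intro i hi hes
    push_cast at hes
    have h1 := ih (i + 1) (by omega) (by nlinarith)
    have h2 := hr (s + 1) (i + 1) (by omega)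
    have h3 := rr_mul_succ hp i
    push_cast at h2
    have h4 : Real.exp (-(2 * ((s + 1 : ℝ) * e))) ≤ rr p (i + 1) := by
      set x := (s + 1 : ℝ) * e with hx
      have hx0 : 0 ≤ x := by positivity
      have hx2 : x ≤ 1 / 2 := by rw [hx]; linarith
      refine le_trans ?_ h2
      rw [Real.exp_neg]
      have := Real.add_one_le_exp (2 * x)
      rw [inv_le_iff_one_le_mul₀ (Real.exp_pos _)]
      nlinarith
    have h5 : Real.exp (-(2 * e) * ((s + 1 : ℕ) : ℝ) ^ 2) ≤
        Real.exp (-(2 * e) * (s : ℝ) ^ 2) * Real.exp (-(2 * ((s + 1 : ℝ) * e))) := by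
      rw [← Real.exp_add]
      apply Real.exp_le_exp.mpr
      push_cast
      have : 0 ≤ e * s := by positivity
      nlinarith
    calc p k * Real.exp (-(2 * e) * ((s + 1 : ℕ) : ℝ) ^ 2)
        ≤ p k * (Real.exp (-(2 * e) * (s : ℝ) ^ 2) * Real.exp (-(2 * ((s + 1 : ℝ) * e)))) :=
          mul_le_mul_of_nonneg_left h5 (hp k).le
      _ = (p k * Real.exp (-(2 * e) * (s : ℝ) ^ 2)) * Real.exp (-(2 * ((s + 1 : ℝ) * e))) := by
          ring
      _ ≤ p (i + 1) * rr p (i + 1) :=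
          mul_le_mul h1 h4 (Real.exp_pos _).le (hp _).le
      _ = p i := h3

lemma small_bound {p : ℕ → ℝ} (hp : ∀ k, 0 < p k) {e : ℝ} (h : SC p e) (k : ℕ) :
    p 0 ≤ p k * (e ^ k * (k.factorial : ℝ)) := by
  have he := SC_nonneg hp h
  have hr : ∀ j : ℕ, rr p j ≤ j * e := by
    intro j
    induction j with
    | zero => simp [rr]
    | succ j ih => have := h j; push_cast; linarith
  induction k with
  | zero => simp
  | succ k ih =>
    refine ih.trans ?_
    rw [← rr_mul_succ hp k, pow_succ, Nat.factorial_succ]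
    have := hr (k + 1)
    calc p (k + 1) * rr p (k + 1) * (e ^ k * (k.factorial : ℝ))
        ≤ p (k + 1) * (((k + 1 : ℕ) : ℝ) * e) * (e ^ k * (k.factorial : ℝ)) := by
          gcongr
          exact (hp _).le
      _ = _ := by push_cast; ring

lemma exists_mode {p : ℕ → ℝ} (hp : ∀ k, 0 < p k) (hs : HasSum p 1) :
    ∃ k, (∀ j, p j ≤ p k) ∧ rr p k ≤ 1 ∧ 1 ≤ rr p (k + 1) := by
  have ht := hs.summable.tendsto_atTop_zero
  have hev := ht.eventually (gt_mem_nhds (hp 0))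
  obtain ⟨M, hM⟩ := Filter.eventually_atTop.mp hev
  obtain ⟨k, hk, hmax⟩ := Finset.exists_max_image (Finset.range (M + 1)) p ⟨0, by simp⟩
  have hall : ∀ j, p j ≤ p k := by
    intro j
    by_cases hj : j < M + 1
    · exact hmax j (by simpa using hj)
    · exact (hM j (by omega)).le.trans (hmax 0 (by simp))
  refine ⟨k, hall, ?_, ?_⟩
  · cases k with
    | zero => simp [rr]
    | succ k => exact (div_le_one (hp _)).mpr (hall _)
  · exact (one_le_div (hp _)).mpr (hall _)

lemma ceil_sq {D : ℝ} (hD : 1 ≤ D) : (⌈√D⌉₊ : ℝ) ≤ 2 * √D ∧ √D ≤ (⌈√D⌉₊ : ℝ) := by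
  have h1 : 1 ≤ √D := Real.one_le_sqrt.mpr hD
  refine ⟨?_, Nat.le_ceil _⟩
  have := Nat.ceil_lt_add_one (Real.sqrt_nonneg D)
  linarith

/-- Each term close (above) to the mode is comparable with the mode. -/
lemma mode_block {p : ℕ → ℝ} (hp : ∀ k, 0 < p k) {a D : ℝ} (hD : 1 ≤ D) (h : SC p (a / D))
    {k : ℕ} (hk : rr p k ≤ 1) (s : ℕ) (hs : s < ⌈√D⌉₊) :
    p k * Real.exp (-(4 * a)) ≤ p (k + s) := by
  refine le_trans ?_ (up_bound hp h hk s)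
  apply mul_le_mul_of_nonneg_left _ (hp k).le
  apply Real.exp_le_exp.mpr
  have he := SC_nonneg hp h
  have hs' : (s : ℝ) ≤ 2 * √D := by
    have : (s : ℝ) ≤ (⌈√D⌉₊ : ℝ) := by exact_mod_cast hs.le
    exact this.trans (ceil_sq hD).1
  have hsq : (s : ℝ) ^ 2 ≤ 4 * D := by
    have h0 : (0 : ℝ) ≤ s := by positivity
    have := Real.sq_sqrt (show 0 ≤ D by linarith)
    nlinarith
  have : a / D * (s : ℝ) ^ 2 ≤ a / D * (4 * D) := mul_le_mul_of_nonneg_left hsq he.le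
  have h2 : a / D * (4 * D) = 4 * a := by field_simp
  linarith

lemma block_sum {p : ℕ → ℝ} (hp : ∀ k, 0 < p k) {a D : ℝ} (hD : 1 ≤ D) (h : SC p (a / D))
    {k : ℕ} (hk : rr p k ≤ 1) :
    √D * (p k * Real.exp (-(4 * a))) ≤ ∑ s ∈ Finset.range ⌈√D⌉₊, p (k + s) := by
  calc √D * (p k * Real.exp (-(4 * a)))
      ≤ (⌈√D⌉₊ : ℝ) * (p k * Real.exp (-(4 * a))) := by
        apply mul_le_mul_of_nonneg_right (ceil_sq hD).2
        exact (mul_pos (hp k) (Real.exp_pos _)).le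
    _ = ∑ s ∈ Finset.range ⌈√D⌉₊, p k * Real.exp (-(4 * a)) := by simp
    _ ≤ _ := Finset.sum_le_sum
        (fun s hs => mode_block hp hD h hk s (Finset.mem_range.mp hs))

lemma shift_sum_le {f : ℕ → ℝ} {F : ℝ} (hf : ∀ k, 0 ≤ f k) (hs : HasSum f F) (k S : ℕ) :
    ∑ s ∈ Finset.range S, f (k + s) ≤ F := by
  rw [← hs.tsum_eq]
  have := hs.summable.sum_le_tsum ((Finset.range S).map (addLeftEmbedding k)) (fun i _ => hf i)
  simpa using this

lemma sup_bound {p : ℕ → ℝ} (hp : ∀ k, 0 < p k) (hs : HasSum p 1) {a D : ℝ} (hD : 0 < D)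
    (h : SC p (a / D)) (j : ℕ) : p j * √D ≤ Real.exp (4 * a) := by
  have he := SC_nonneg hp h
  have ha : 0 < a := by
    have := mul_pos he hD
    rwa [div_mul_cancel₀ _ hD.ne'] at this
  obtain ⟨k, hall, hk1, hk2⟩ := exists_mode hp hs
  by_cases hD1 : 1 ≤ D
  · have h1 := block_sum hp hD1 h hk1
    have h2 := shift_sum_le (fun k => (hp k).le) hs k ⌈√D⌉₊
    have h3 : √D * p k * Real.exp (-(4 * a)) ≤ 1 := by linarith
    rw [Real.exp_neg, ← div_eq_mul_inv, div_le_one (Real.exp_pos _)] at h3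
    have := mul_le_mul_of_nonneg_right (hall j) (Real.sqrt_nonneg D)
    linarith
  · have h1 : p j ≤ 1 := by
      have := shift_sum_le (fun k => (hp k).le) hs j 1
      simpa using this
    have h2 : √D ≤ 1 := Real.sqrt_le_one.mpr (by linarith)
    have h3 : 1 ≤ Real.exp (4 * a) := Real.one_le_exp (by linarith)
    have := mul_le_mul h1 h2 (Real.sqrt_nonneg _) zero_le_one
    linarith

/-- Chebyshev: the mode is at least of order `1/√D`. -/
lemma mode_lower {p : ℕ → ℝ} (hp : ∀ k, 0 < p k) {N : ℕ} {V CV D : ℝ} (hm : Mom p N V)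
    (hCV : 0 < CV) (hD : 1 ≤ D) (hV : V ≤ CV * D) {k : ℕ} (hall : ∀ j, p j ≤ p k) :
    1 / (2 * (2 * √(2 * CV) + 3)) ≤ p k * √D := by
  obtain ⟨m0, -, m2⟩ := hm
  set T := 2 * CV * D with hT
  have hTpos : 0 < T := by positivity
  set L := ⌈√T⌉₊ with hL
  have hLT : √T ≤ L := Nat.le_ceil _
  have hL2 : (L : ℝ) < √T + 1 := Nat.ceil_lt_add_one (Real.sqrt_nonneg _)
  have hpt : ∀ j, p j ≤ (if j ∈ Finset.Icc (N - L) (N + L) then p j else 0)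
      + ((j : ℝ) - N) ^ 2 * p j / T := by
    intro j
    split_ifs with hj
    · have : 0 ≤ ((j : ℝ) - N) ^ 2 * p j / T := by
        have := (hp j).le
        positivity
      linarith
    · rw [zero_add, le_div_iff₀ hTpos, mul_comm]
      apply mul_le_mul_of_nonneg_right _ (hp j).le
      have hLsq : T ≤ (L : ℝ) ^ 2 := by
        have := Real.sq_sqrt hTpos.le
        have := Real.sqrt_nonneg T
        nlinarith
      refine hLsq.trans ?_
      rw [Finset.mem_Icc] at hj
      have hL0 : (0 : ℝ) ≤ L := by positivity
      by_cases h1 : j ≤ N + L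
      · have h2 : j + L ≤ N := by omega
        have h2' : (j : ℝ) + L ≤ N := by exact_mod_cast h2
        nlinarith
      · have h2 : N + L ≤ j := by omega
        have h2' : (N : ℝ) + L ≤ j := by exact_mod_cast h2
        nlinarith
  have hsum1 : HasSum (fun j => if j ∈ Finset.Icc (N - L) (N + L) then p j else 0)
      (∑ j ∈ Finset.Icc (N - L) (N + L), p j) := by
    have := hasSum_sum_of_ne_finset_zero (L := SummationFilter.unconditional ℕ)
      (f := fun j => if j ∈ Finset.Icc (N - L) (N + L) then p j else 0)
      (s := Finset.Icc (N - L) (N + L)) (fun b hb => by simp [hb])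
    convert this using 1
    exact Finset.sum_congr rfl (fun j hj => by simp only [hj, if_true])
  have hle := hasSum_le hpt m0 (hsum1.add (m2.div_const T))
  have hVT : V / T ≤ 1 / 2 := by
    rw [div_le_iff₀ hTpos]
    linarith
  have hcard : ∑ j ∈ Finset.Icc (N - L) (N + L), p j ≤ (2 * L + 1 : ℝ) * p k := by
    calc _ ≤ ∑ j ∈ Finset.Icc (N - L) (N + L), p k := Finset.sum_le_sum (fun j _ => hall j)
      _ = ((Finset.Icc (N - L) (N + L)).card : ℝ) * p k := by simp
      _ ≤ _ := by
        apply mul_le_mul_of_nonneg_right _ (hp k).le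
        have : (Finset.Icc (N - L) (N + L)).card ≤ 2 * L + 1 := by
          rw [Nat.card_Icc]
          omega
        exact_mod_cast this
  have hsqT : √T = √(2 * CV) * √D := by
    rw [hT, Real.sqrt_mul (by positivity)]
  have hD1 : 1 ≤ √D := Real.one_le_sqrt.mpr hD
  have hpk := hp k
  have hLb : (2 * L + 1 : ℝ) ≤ (2 * √(2 * CV) + 3) * √D := by
    have : 0 ≤ √(2 * CV) := Real.sqrt_nonneg _
    nlinarith
  have hfin : 1 / 2 ≤ (2 * √(2 * CV) + 3) * √D * p k := by
    have := mul_le_mul_of_nonneg_right hLb hpk.le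
    linarith
  have h3 : 0 < 2 * √(2 * CV) + 3 := by positivity
  rw [div_le_iff₀ (by positivity)]
  nlinarith

lemma lower_bound (a CV : ℝ) (ha : 0 < a) (hCV : 0 < CV) :
    ∃ D₀ κ : ℝ, 1 ≤ D₀ ∧ 0 < κ ∧ ∀ (p : ℕ → ℝ) (N : ℕ) (V D : ℝ), (∀ k, 0 < p k) →
      Mom p N V → D₀ ≤ D → V ≤ CV * D → SC p (a / D) → κ ≤ p N * √D := by
  set κ₀ := 1 / (2 * (2 * √(2 * CV) + 3)) with hκ₀
  have hκ₀pos : 0 < κ₀ := by positivity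
  set κ₁ := κ₀ * Real.exp (-(4 * a)) with hκ₁
  have hκ₁pos : 0 < κ₁ := by positivity
  set K := 3 + CV / κ₁ with hK
  have hK3 : 3 < K := by
    have : 0 < CV / κ₁ := by positivity
    linarith
  refine ⟨max 1 ((2 * a * K) ^ 2), κ₀ * Real.exp (-(2 * a * K ^ 2)), le_max_left _ _,
    by positivity, ?_⟩
  intro p N V D hp hm hD0 hV hSC
  have hD : 1 ≤ D := (le_max_left _ _).trans hD0
  have hDK : 2 * a * K ≤ √D := Real.le_sqrt_of_sq_le ((le_max_right _ _).trans hD0)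
  have hDpos : 0 < D := by linarith
  have hsD : √D * √D = D := Real.mul_self_sqrt hDpos.le
  have hsD1 : 1 ≤ √D := Real.one_le_sqrt.mpr hD
  obtain ⟨k, hall, hk1, hk2⟩ := exists_mode hp hm.1
  have hlow : κ₀ ≤ p k * √D := mode_lower hp hm hCV hD hV hall
  have hblock := block_sum hp hD hSC hk1
  have hblock' : κ₁ ≤ ∑ s ∈ Finset.range ⌈√D⌉₊, p (k + s) := by
    refine le_trans ?_ hblock
    rw [hκ₁]
    have := mul_le_mul_of_nonneg_right hlow (Real.exp_pos (-(4 * a))).le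
    linarith
  have hloc : |(k : ℝ) - N| ≤ K * √D := by
    by_contra hcon
    push Not at hcon
    have h2 := shift_sum_le (f := fun k : ℕ => ((k : ℝ) - N) ^ 2 * p k)
      (fun k => mul_nonneg (sq_nonneg _) (hp k).le) hm.2.2 k ⌈√D⌉₊
    have h3 : ((K - 2) * √D) ^ 2 * ∑ s ∈ Finset.range ⌈√D⌉₊, p (k + s)
        ≤ ∑ s ∈ Finset.range ⌈√D⌉₊, (((k + s : ℕ) : ℝ) - N) ^ 2 * p (k + s) := by
      rw [Finset.mul_sum]
      apply Finset.sum_le_sum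
      intro s hs
      apply mul_le_mul_of_nonneg_right _ (hp _).le
      have hs' : (s : ℝ) ≤ 2 * √D := by
        have : (s : ℝ) ≤ (⌈√D⌉₊ : ℝ) := by exact_mod_cast (Finset.mem_range.mp hs).le
        exact this.trans (ceil_sq hD).1
      have hs0 : (0 : ℝ) ≤ s := by positivity
      rw [← sq_abs (((k + s : ℕ) : ℝ) - N)]
      apply pow_le_pow_left₀ (by nlinarith)
      push_cast
      have h5 := abs_sub_abs_le_abs_sub ((k : ℝ) - N) (-(s : ℝ))
      rw [abs_neg, abs_of_nonneg hs0, show (k : ℝ) - N - -(s : ℝ) = k + s - N by ring] at h5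
      linarith
    have h4 : ((K - 2) * √D) ^ 2 * κ₁ ≤ CV * D :=
      ((mul_le_mul_of_nonneg_left hblock' (sq_nonneg _)).trans h3).trans (h2.trans hV)
    have h5 : ((K - 2) * √D) ^ 2 = (K - 2) ^ 2 * D := by rw [mul_pow, Real.sq_sqrt hDpos.le]
    rw [h5] at h4
    have h6 : (K - 2) ^ 2 * κ₁ ≤ CV := by
      have : (K - 2) ^ 2 * κ₁ * D ≤ CV * D := by linarith
      exact le_of_mul_le_mul_right this hDpos
    have h7 : CV = (K - 3) * κ₁ := by
      rw [hK]
      field_simp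
      ring
    rw [h7] at h6
    have := le_of_mul_le_mul_right h6 hκ₁pos
    nlinarith
  have hcomp : p k * Real.exp (-(2 * a * K ^ 2)) ≤ p N := by
    have hexp : ∀ s : ℕ, (s : ℝ) ≤ K * √D →
        a / D * (s : ℝ) ^ 2 ≤ a * K ^ 2 ∧ a / D * s ≤ 1 / 2 := by
      intro s hs
      have hs0 : (0 : ℝ) ≤ s := by positivity
      have hsq : (s : ℝ) ^ 2 ≤ K ^ 2 * D := by
        calc (s : ℝ) ^ 2 ≤ (K * √D) ^ 2 := pow_le_pow_left₀ hs0 hs 2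
          _ = K ^ 2 * D := by rw [mul_pow, Real.sq_sqrt hDpos.le]
      constructor
      · rw [div_mul_eq_mul_div, div_le_iff₀ hDpos]
        nlinarith
      · rw [div_mul_eq_mul_div, div_le_iff₀ hDpos]
        have : a * s ≤ a * (K * √D) := mul_le_mul_of_nonneg_left hs ha.le
        nlinarith
    rcases le_total k N with hkN | hkN
    · obtain ⟨s, rfl⟩ := Nat.exists_eq_add_of_le hkN
      have hs : (s : ℝ) ≤ K * √D := by
        push_cast at hloc
        rw [show (k : ℝ) - (k + s) = -s by ring, abs_neg, abs_of_nonneg (by positivity)] at hloc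
        exact hloc
      refine le_trans ?_ (up_bound hp hSC hk1 s)
      apply mul_le_mul_of_nonneg_left _ (hp k).le
      apply Real.exp_le_exp.mpr
      have := (hexp s hs).1
      have : 0 ≤ a * K ^ 2 := by positivity
      linarith
    · obtain ⟨s, rfl⟩ := Nat.exists_eq_add_of_le hkN
      have hs : (s : ℝ) ≤ K * √D := by
        push_cast at hloc
        rw [show (N : ℝ) + s - N = s by ring, abs_of_nonneg (by positivity)] at hloc
        exact hloc
      refine le_trans ?_ (down_bound hp hSC hk2 s N rfl (hexp s hs).2)
      apply mul_le_mul_of_nonneg_left _ (hp _).le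
      apply Real.exp_le_exp.mpr
      have := (hexp s hs).1
      linarith
  have h1 := mul_le_mul_of_nonneg_right hcomp (Real.sqrt_nonneg D)
  have h2 := mul_le_mul_of_nonneg_right hlow (Real.exp_pos (-(2 * a * K ^ 2))).le
  linarith

lemma hs_congr {f g : ℕ → ℝ} {F G : ℝ} (h : HasSum f F) (h1 : ∀ k, g k = f k) (h2 : G = F) :
    HasSum g G := by
  rw [h2, funext h1]
  exact h

lemma c_linear_lower {c : ℕ → ℝ} {a₂ : ℝ} {k₀ : ℕ} (hc0 : c 0 = 0)
    (hcpos : ∀ n : ℕ, 0 < n → 0 < c n) (hk₀ : 0 < k₀) (ha₂ : 0 < a₂)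
    (hM : ∀ j k : ℕ, j + k₀ ≤ k → a₂ ≤ c k - c j) :
    ∃ c₁ : ℝ, 0 < c₁ ∧ ∀ k : ℕ, c₁ * k ≤ c k := by
  obtain ⟨i, hi, hmin⟩ := Finset.exists_min_image (Finset.Icc 1 k₀) c ⟨1, by simp; omega⟩
  have hi1 : 0 < c i := hcpos i (by simp at hi; omega)
  have hk₀' : (0 : ℝ) < k₀ := by exact_mod_cast hk₀
  refine ⟨min (c i) a₂ / k₀, by positivity, ?_⟩
  set c₁ := min (c i) a₂ / k₀ with hc₁
  have hc₁pos : 0 < c₁ := by positivity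
  have hc₁k : c₁ * k₀ = min (c i) a₂ := by rw [hc₁]; field_simp
  intro k
  induction k using Nat.strong_induction_on with
  | _ k ih =>
    rcases Nat.eq_zero_or_pos k with rfl | hk
    · simp [hc0]
    by_cases hkk : k ≤ k₀
    · have h1 := hmin k (by simp; omega)
      have h2 : (k : ℝ) ≤ k₀ := by exact_mod_cast hkk
      have h3 := min_le_left (c i) a₂
      have h4 := mul_le_mul_of_nonneg_left h2 hc₁pos.le
      linarith
    · push Not at hkk
      obtain ⟨j, rfl⟩ := Nat.exists_eq_add_of_le hkk.le
      have h1 := ih j (by omega)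
      have h2 := hM j (k₀ + j) (by omega)
      have h3 := min_le_right (c i) a₂
      push_cast
      linarith

lemma c_lip {c : ℕ → ℝ} {a₁ : ℝ} (hLG : ∀ k : ℕ, |c (k + 1) - c k| ≤ a₁) (j s : ℕ) :
    |c (j + s) - c j| ≤ a₁ * s := by
  induction s with
  | zero => simp
  | succ s ih =>
    have h1 := hLG (j + s)
    rw [abs_le] at *
    rw [← add_assoc]
    push_cast
    constructor <;> linarith [h1.1, h1.2, ih.1, ih.2]

lemma c_growth {c : ℕ → ℝ} {a₁ a₂ : ℝ} {k₀ : ℕ} (hLG : ∀ k : ℕ, |c (k + 1) - c k| ≤ a₁)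
    (hk₀ : 0 < k₀) (ha₂ : 0 < a₂) (hM : ∀ j k : ℕ, j + k₀ ≤ k → a₂ ≤ c k - c j) (j s : ℕ) :
    a₂ / k₀ * s - (a₂ + a₁ * k₀) ≤ c (j + s) - c j := by
  have hk₀' : (0 : ℝ) < k₀ := by exact_mod_cast hk₀
  have ha₁ : 0 ≤ a₁ := (abs_nonneg _).trans (hLG 0)
  have hak : a₂ / k₀ * k₀ = a₂ := by field_simp
  have hapos : 0 < a₂ / k₀ := by positivity
  induction s using Nat.strong_induction_on with
  | _ s ih =>
    by_cases hs : s < k₀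
    · have h1 := (abs_le.mp (c_lip hLG j s)).1
      have h2 : (s : ℝ) ≤ k₀ := by exact_mod_cast hs.le
      have h3 := mul_le_mul_of_nonneg_left h2 ha₁
      have h4 := mul_le_mul_of_nonneg_left h2 hapos.le
      linarith
    · push Not at hs
      obtain ⟨t, rfl⟩ := Nat.exists_eq_add_of_le hs
      have h1 := ih t (by omega)
      have h2 := hM (j + t) (j + (k₀ + t)) (by omega)
      push_cast
      linarith

lemma v_bound {c v : ℕ → ℝ} {α c₁ : ℝ} (hα : 0 < α) (hc₁ : 0 < c₁) (hcl : ∀ k : ℕ, c₁ * k ≤ c k)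
    (hv : ∀ k, 0 < v k) (hrec : ∀ k, c (k + 1) * v (k + 1) = α * v k) (k : ℕ) :
    v k ≤ v 0 * ((α / c₁) ^ k / (k.factorial : ℝ)) := by
  induction k with
  | zero => simp
  | succ k ih =>
    have h1 := hrec k
    have h2 := hcl (k + 1)
    have h3 := mul_le_mul_of_nonneg_right h2 (hv (k + 1)).le
    rw [h1] at h3
    have hk : (0 : ℝ) < ((k + 1 : ℕ) : ℝ) := by positivity
    have h4 : v (k + 1) ≤ α * v k / (c₁ * ((k + 1 : ℕ) : ℝ)) := by
      rw [le_div_iff₀ (by positivity)]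
      linarith
    refine h4.trans ?_
    have h5 : α * v k / (c₁ * ((k + 1 : ℕ) : ℝ)) ≤
        α * (v 0 * ((α / c₁) ^ k / (k.factorial : ℝ))) / (c₁ * ((k + 1 : ℕ) : ℝ)) := by
      gcongr
    refine h5.trans (le_of_eq ?_)
    rw [Nat.factorial_succ, pow_succ]
    push_cast
    have : (k.factorial : ℝ) ≠ 0 := by positivity
    field_simp

lemma v_summable {c v : ℕ → ℝ} {α c₁ : ℝ} (hα : 0 < α) (hc₁ : 0 < c₁)
    (hcl : ∀ k : ℕ, c₁ * k ≤ c k)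
    (hv : ∀ k, 0 < v k) (hrec : ∀ k, c (k + 1) * v (k + 1) = α * v k) (i : ℕ) :
    Summable (fun k : ℕ => (k : ℝ) ^ i * v k) := by
  have hs := (Real.summable_pow_div_factorial (2 ^ i * (α / c₁))).mul_left (v 0)
  refine Summable.of_nonneg_of_le (fun k => mul_nonneg (by positivity) (hv k).le) (fun k => ?_) hs
  have h1 := v_bound hα hc₁ hcl hv hrec k
  have h2 : (k : ℝ) ^ i ≤ (2 ^ i) ^ k := by
    rw [← pow_mul, mul_comm, pow_mul]
    apply pow_le_pow_left₀ (by positivity)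
    exact_mod_cast Nat.lt_two_pow_self.le
  have h3 := mul_le_mul h2 h1 (hv k).le (by positivity)
  refine h3.trans (le_of_eq ?_)
  rw [mul_pow]
  ring

lemma hasSum_shift {c w g : ℕ → ℝ} {α L : ℝ} (hc0 : c 0 = 0)
    (hrec : ∀ k, c (k + 1) * w (k + 1) = α * w k)
    (h : HasSum (fun k => g (k + 1) * w k) L) : HasSum (fun k => c k * g k * w k) (α * L) := by
  have h1 : HasSum (fun k => c (k + 1) * g (k + 1) * w (k + 1)) (α * L) := by
    refine hs_congr (h.mul_left α) (fun k => ?_) rfl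
    calc _ = c (k + 1) * w (k + 1) * g (k + 1) := by ring
      _ = _ := by rw [hrec]; ring
  have := (hasSum_nat_add_iff (f := fun k => c k * g k * w k) 1).mp h1
  simpa [hc0] using this

/-- One-site law data. -/
structure Site (c : ℕ → ℝ) (α ρ M : ℝ) (w : ℕ → ℝ) : Prop where
  pos : ∀ k, 0 < w k
  hrec : ∀ k, c (k + 1) * w (k + 1) = α * w k
  s0 : HasSum w 1
  s1 : HasSum (fun k : ℕ => (k : ℝ) * w k) ρ
  s2 : HasSum (fun k : ℕ => (k : ℝ) ^ 2 * w k) M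

lemma Site.mom {c : ℕ → ℝ} {α ρ M : ℝ} {w : ℕ → ℝ} (h : Site c α ρ M w) :
    Mom w ρ (M - ρ ^ 2) := by
  refine ⟨h.s0, ?_, ?_⟩
  · have := h.s1.sub (h.s0.mul_left ρ)
    refine hs_congr this (fun k => ?_) ?_
    · ring
    · ring
  · have := (h.s2.sub (h.s1.mul_left (2 * ρ))).add (h.s0.mul_left (ρ ^ 2))
    refine hs_congr this (fun k => ?_) ?_
    · ring
    · ring

lemma Site.mean_c {c : ℕ → ℝ} {α ρ M : ℝ} {w : ℕ → ℝ} (h : Site c α ρ M w) (hc0 : c 0 = 0) :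
    HasSum (fun k => c k * w k) α := by
  have := hasSum_shift (g := fun _ => 1) hc0 h.hrec (by simpa using h.s0)
  simpa using this

lemma Site.le_alpha {c : ℕ → ℝ} {α ρ M c₁ : ℝ} {w : ℕ → ℝ} (h : Site c α ρ M w) (hc0 : c 0 = 0)
    (hcl : ∀ k : ℕ, c₁ * k ≤ c k) : c₁ * ρ ≤ α := by
  refine hasSum_le (fun k => ?_) (h.s1.mul_left c₁) (h.mean_c hc0)
  have := mul_le_mul_of_nonneg_right (hcl k) (h.pos k).le
  linarith

lemma Site.sc {c : ℕ → ℝ} {α ρ M a₁ : ℝ} {w : ℕ → ℝ} (h : Site c α ρ M w) (hc0 : c 0 = 0)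
    (hα : 0 < α) (hLG : ∀ k : ℕ, |c (k + 1) - c k| ≤ a₁) : SC w (a₁ / α) := by
  have hr : ∀ k, rr w k = c k / α := by
    intro k
    cases k with
    | zero => simp [rr, hc0]
    | succ k =>
      have := h.hrec k
      have := h.pos (k + 1)
      simp only [rr]
      rw [div_eq_div_iff (by positivity) (by positivity)]
      linarith
  intro k
  rw [hr, hr, ← add_div]
  apply div_le_div_of_nonneg_right _ hα.le
  linarith [(abs_le.mp (hLG k)).2]

lemma Site.w0 {c : ℕ → ℝ} {α ρ M c₁ : ℝ} {w : ℕ → ℝ} (h : Site c α ρ M w)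
    (hα : 0 < α) (hc₁ : 0 < c₁) (hcl : ∀ k : ℕ, c₁ * k ≤ c k) :
    Real.exp (-(α / c₁)) ≤ w 0 := by
  have h1 : HasSum (fun k : ℕ => (α / c₁) ^ k / (k.factorial : ℝ)) (Real.exp (α / c₁)) := by
    rw [Real.exp_eq_exp_ℝ]
    exact NormedSpace.expSeries_div_hasSum_exp (α / c₁)
  have h2 := hasSum_le (v_bound hα hc₁ hcl h.pos h.hrec) h.s0 (h1.mul_left (w 0))
  rw [Real.exp_neg, inv_le_iff_one_le_mul₀ (Real.exp_pos _)]
  exact h2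

lemma site_variance {c : ℕ → ℝ} {a₁ a₂ c₁ : ℝ} {k₀ : ℕ} (hc0 : c 0 = 0)
    (hLG : ∀ k : ℕ, |c (k + 1) - c k| ≤ a₁)
    (hk₀ : 0 < k₀) (ha₂ : 0 < a₂) (hM : ∀ j k : ℕ, j + k₀ ≤ k → a₂ ≤ c k - c j)
    (hc₁ : 0 < c₁) (hcl : ∀ k : ℕ, c₁ * k ≤ c k) :
    ∃ CV : ℝ, 0 < CV ∧ ∀ (α ρ M : ℝ) (w : ℕ → ℝ), 0 < α → Site c α ρ M w →
      M - ρ ^ 2 ≤ CV * α := by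
  have ha₁ : 0 ≤ a₁ := (abs_nonneg _).trans (hLG 0)
  have hk₀' : (0 : ℝ) < k₀ := by exact_mod_cast hk₀
  set a := a₂ / k₀ with ha
  have hapos : 0 < a := by positivity
  set B := a₂ + a₁ * k₀ + a₁ with hB
  have hB0 : 0 ≤ B := by positivity
  refine ⟨2 / a * (1 + B ^ 2 / (2 * a)) + 1 / c₁ * (1 + 1 / c₁), by positivity, ?_⟩
  intro α ρ M w hα h
  have hA : 0 ≤ 2 / a * (1 + B ^ 2 / (2 * a)) * α := by positivity
  have hA' : 0 ≤ 1 / c₁ * (1 + 1 / c₁) * α := by positivity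
  rw [add_mul]
  by_cases hα1 : α < 1
  · have h1 : HasSum (fun k : ℕ => c k * (k : ℝ) * w k) (α * (ρ + 1)) := by
      apply hasSum_shift (g := fun k : ℕ => (k : ℝ)) hc0 h.hrec
      refine hs_congr (h.s1.add h.s0) (fun k => ?_) rfl
      push_cast
      ring
    have h2 : c₁ * M ≤ α * (ρ + 1) := by
      refine hasSum_le (fun k => ?_) (h.s2.mul_left c₁) h1
      have := mul_le_mul_of_nonneg_right (hcl k)
        (mul_nonneg (Nat.cast_nonneg k) (h.pos k).le : (0 : ℝ) ≤ k * w k)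
      nlinarith
    have h3 := h.le_alpha hc0 hcl
    have h4 : ρ ≤ 1 / c₁ := by
      rw [le_div_iff₀ hc₁]
      linarith
    have h5 : M ≤ 1 / c₁ * (1 + 1 / c₁) * α := by
      have : c₁ * M ≤ α * (1 / c₁ + 1) := h2.trans (by gcongr)
      have h6 : c₁ * (1 / c₁ * (1 + 1 / c₁) * α) = α * (1 / c₁ + 1) := by field_simp; ring
      rw [← h6] at this
      exact le_of_mul_le_mul_left this hc₁
    nlinarith [sq_nonneg ρ]
  · push Not at hα1
    have hex : ∃ x, α < c (x + 1) := by
      obtain ⟨x, hx⟩ := exists_nat_gt (α / c₁)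
      rw [div_lt_iff₀ hc₁] at hx
      refine ⟨x, ?_⟩
      have := hcl (x + 1)
      push_cast at this
      linarith
    obtain ⟨x, hx1, hx2⟩ : ∃ x, c x ≤ α ∧ α < c (x + 1) := by
      classical
      refine ⟨Nat.find hex, ?_, Nat.find_spec hex⟩
      by_contra hcon
      push Not at hcon
      rcases hfx : Nat.find hex with _ | y
      · rw [hfx, hc0] at hcon
        linarith
      · rw [hfx] at hcon
        have := Nat.find_min hex (m := y) (by omega)
        exact this hcon
    have hxl := abs_le.mp (hLG x)
    have hpt : ∀ k : ℕ, a / 2 * ((k : ℝ) - x) ^ 2 - B ^ 2 / (2 * a) ≤ (c k - α) * ((k : ℝ) - x) := by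
      have hq : ∀ t : ℝ, a / 2 * t ^ 2 - B ^ 2 / (2 * a) ≤ (a * t - B) * t := by
        intro t
        have : (a * t - B) * t - (a / 2 * t ^ 2 - B ^ 2 / (2 * a)) = (a * t - B) ^ 2 / (2 * a) := by
          field_simp
          ring
        have h2 : 0 ≤ (a * t - B) ^ 2 / (2 * a) := by positivity
        linarith
      intro k
      rcases le_total x k with hk | hk
      · obtain ⟨s, rfl⟩ := Nat.exists_eq_add_of_le hk
        have h1 := c_growth hLG hk₀ ha₂ hM x s
        have h2 := hq s
        have hs : (0 : ℝ) ≤ s := by positivity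
        have h3 : a * s - B ≤ c (x + s) - α := by linarith [hxl.2]
        have h4 := mul_le_mul_of_nonneg_right h3 hs
        have h5 : ((x + s : ℕ) : ℝ) - x = s := by push_cast; ring
        rw [h5]
        linarith
      · obtain ⟨s, rfl⟩ := Nat.exists_eq_add_of_le hk
        have h1 := c_growth hLG hk₀ ha₂ hM k s
        have h2 := hq s
        have hs : (0 : ℝ) ≤ s := by positivity
        have h3 : a * s - B ≤ α - c k := by linarith [hxl.2]
        have h4 := mul_le_mul_of_nonneg_right h3 hs
        have h5 : (k : ℝ) - ((k + s : ℕ) : ℝ) = -s := by push_cast; ring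
        rw [h5]
        nlinarith
    have h1 : HasSum (fun k : ℕ => c k * ((k : ℝ) - x) * w k) (α * (ρ + (1 - x))) := by
      apply hasSum_shift (g := fun k : ℕ => (k : ℝ) - x) hc0 h.hrec
      have := h.s1.add (h.s0.mul_left (1 - (x : ℝ)))
      refine hs_congr this (fun k => ?_) ?_
      · push_cast
        ring
      · ring
    have h2 : HasSum (fun k : ℕ => (c k - α) * ((k : ℝ) - x) * w k) α := by
      have := (h1.sub (h.s1.mul_left α)).add (h.s0.mul_left (α * x))
      refine hs_congr this (fun k => ?_) ?_
      · ring
      · ring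
    have h3 : HasSum (fun k : ℕ => (a / 2 * ((k : ℝ) - x) ^ 2 - B ^ 2 / (2 * a)) * w k)
        (a / 2 * (M - 2 * x * ρ + x ^ 2) - B ^ 2 / (2 * a)) := by
      have := ((h.s2.mul_left (a / 2)).sub (h.s1.mul_left (a * x))).add
        (h.s0.mul_left (a / 2 * x ^ 2 - B ^ 2 / (2 * a)))
      refine hs_congr this (fun k => ?_) ?_
      · ring
      · ring
    have h4 := hasSum_le (fun k => mul_le_mul_of_nonneg_right (hpt k) (h.pos k).le) h3 h2
    have h5 : M - ρ ^ 2 ≤ M - 2 * x * ρ + x ^ 2 := by nlinarith [sq_nonneg (ρ - x)]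
    have h6 : a / 2 * (M - ρ ^ 2) ≤ α + B ^ 2 / (2 * a) := by
      have := mul_le_mul_of_nonneg_left h5 (show 0 ≤ a / 2 by positivity)
      linarith
    have h7 : α + B ^ 2 / (2 * a) ≤ (1 + B ^ 2 / (2 * a)) * α := by
      have : 0 ≤ B ^ 2 / (2 * a) := by positivity
      nlinarith
    have h8 : a / 2 * (2 / a * (1 + B ^ 2 / (2 * a)) * α) = (1 + B ^ 2 / (2 * a)) * α := by
      field_simp
    have h9 : M - ρ ^ 2 ≤ 2 / a * (1 + B ^ 2 / (2 * a)) * α := by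
      apply le_of_mul_le_mul_left _ (show 0 < a / 2 by positivity)
      rw [h8]
      linarith
    linarith

lemma core {c : ℕ → ℝ} {a₁ a₂ : ℝ} {k₀ : ℕ} (hc0 : c 0 = 0)
    (hLG : ∀ k : ℕ, |c (k + 1) - c k| ≤ a₁)
    (hk₀ : 0 < k₀) (ha₂ : 0 < a₂) (hM : ∀ j k : ℕ, j + k₀ ≤ k → a₂ ≤ c k - c j)
    {c₁ : ℝ} (hc₁ : 0 < c₁) (hcl : ∀ k : ℕ, c₁ * k ≤ c k) {δ₀ : ℝ} (hδ : δ₀ < 1) :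
    ∃ A₀ : ℝ, 0 < A₀ ∧ ∀ (α ρ M : ℝ) (w : ℕ → ℝ), 0 < α → Site c α ρ M w →
      ∀ n m N : ℕ, (1 - δ₀) * ((n : ℝ) + 1) ≤ (m : ℝ) + 1 → 1 ≤ N → ((n : ℝ) + 1) * ρ = N →
      ∀ j, pw w m j ≤ A₀ * pw w n N := by
  have hca : c₁ ≤ a₁ := by
    have h1 := hcl 1
    have h2 := (abs_le.mp (hLG 0)).2
    rw [zero_add, hc0] at h2
    push_cast at h1
    linarith
  have ha₁ : 0 < a₁ := by linarith
  obtain ⟨CV, hCV, hvar⟩ := site_variance hc0 hLG hk₀ ha₂ hM hc₁ hcl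
  obtain ⟨D₀, κ, hD₀, hκ, hlow⟩ := lower_bound a₁ CV ha₁ hCV
  set L := ⌈D₀ / c₁⌉₊ with hL
  have hδ' : 0 < √(1 - δ₀) := Real.sqrt_pos.mpr (by linarith)
  set A₁ := Real.exp (4 * a₁) / (√(1 - δ₀) * κ) with hA₁
  set A₂ := Real.exp (D₀ / c₁) * ((a₁ / c₁) ^ L * (L.factorial : ℝ)) with hA₂
  have hA₁pos : 0 < A₁ := by positivity
  have hA₂pos : 0 < A₂ := by positivity
  refine ⟨A₁ + A₂, by positivity, ?_⟩
  intro α ρ M w hα h n m N hmn hN hNρ j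
  have hpn := pw_pos h.pos n
  have hpm := pw_pos h.pos m
  have hn1 : (0 : ℝ) < (n : ℝ) + 1 := by positivity
  have hm1 : (0 : ℝ) < (m : ℝ) + 1 := by positivity
  set D := ((n : ℝ) + 1) * α with hD
  have hDpos : 0 < D := by positivity
  have hsc := SC_pw h.pos (h.sc hc0 hα hLG) n
  rw [div_div, mul_comm α, ← hD] at hsc
  have hscm := SC_pw h.pos (h.sc hc0 hα hLG) m
  rw [div_div, mul_comm α] at hscm
  have hmomn := Mom_pw h.mom n
  rw [hNρ] at hmomn
  have hmomm := Mom_pw h.mom m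
  have hcN : c₁ * N ≤ D := by
    rw [← hNρ, hD]
    have := mul_le_mul_of_nonneg_left (h.le_alpha hc0 hcl) hn1.le
    linarith
  have hpN := hpn N
  rw [add_mul]
  by_cases hDD : D₀ ≤ D
  · have h1 := hlow _ N _ D hpn hmomn hDD (by
      have := mul_le_mul_of_nonneg_left (hvar α ρ M w hα h) hn1.le
      rw [hD]
      linarith) hsc
    have h2 := sup_bound hpm hmomm.1 (by positivity) hscm j
    have h3 : √(1 - δ₀) * √D ≤ √(((m : ℝ) + 1) * α) := by
      rw [← Real.sqrt_mul (by linarith)]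
      apply Real.sqrt_le_sqrt
      rw [hD]
      have := mul_le_mul_of_nonneg_right hmn hα.le
      linarith
    have h4 : pw w m j * (√(1 - δ₀) * √D) ≤ Real.exp (4 * a₁) :=
      (mul_le_mul_of_nonneg_left h3 (hpm j).le).trans h2
    have h5 : pw w m j ≤ A₁ * pw w n N := by
      have hsD : 0 < √D := Real.sqrt_pos.mpr hDpos
      have h6 : Real.exp (4 * a₁) = A₁ * (√(1 - δ₀) * κ) := by
        rw [hA₁]
        field_simp
      have h7 : A₁ * (√(1 - δ₀) * κ) ≤ A₁ * (√(1 - δ₀) * (pw w n N * √D)) := by gcongr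
      have h8 : pw w m j * (√(1 - δ₀) * √D) ≤ A₁ * pw w n N * (√(1 - δ₀) * √D) := by
        rw [h6] at h4
        linarith
      exact le_of_mul_le_mul_right h8 (by positivity)
    have : 0 ≤ A₂ * pw w n N := by positivity
    linarith
  · push Not at hDD
    have h1 : pw w m j ≤ 1 := by
      have := shift_sum_le (fun k => (hpm k).le) hmomm.1 j 1
      simpa using this
    have h2 := small_bound hpn hsc N
    have hNL : N ≤ L := by
      have : (N : ℝ) ≤ D₀ / c₁ := by
        rw [le_div_iff₀ hc₁]
        linarith
      exact_mod_cast this.trans (Nat.le_ceil _)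
    have hN1 : (1 : ℝ) ≤ N := by exact_mod_cast hN
    have h3 : a₁ / D ≤ a₁ / c₁ := by
      apply div_le_div_of_nonneg_left ha₁.le hc₁
      nlinarith
    have h4 : (a₁ / D) ^ N ≤ (a₁ / c₁) ^ L := by
      calc (a₁ / D) ^ N ≤ (a₁ / c₁) ^ N := pow_le_pow_left₀ (by positivity) h3 N
        _ ≤ _ := pow_le_pow_right₀ ((one_le_div hc₁).mpr hca) hNL
    have h5 : (N.factorial : ℝ) ≤ L.factorial := by
      exact_mod_cast Nat.factorial_le hNL
    have h6 : Real.exp (-(D₀ / c₁)) ≤ pw w n 0 := by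
      rw [pw_zero]
      calc Real.exp (-(D₀ / c₁)) ≤ Real.exp (-(α / c₁)) ^ (n + 1) := by
            rw [← Real.exp_nat_mul]
            apply Real.exp_le_exp.mpr
            have : D / c₁ ≤ D₀ / c₁ := by gcongr
            push_cast
            rw [hD] at this
            have h9 : ((n : ℝ) + 1) * -(α / c₁) = -(((n : ℝ) + 1) * α / c₁) := by ring
            rw [h9]
            linarith
        _ ≤ _ := pow_le_pow_left₀ (Real.exp_pos _).le (h.w0 hα hc₁ hcl) _
    have h7 : Real.exp (-(D₀ / c₁)) ≤ pw w n N * ((a₁ / c₁) ^ L * (L.factorial : ℝ)) := by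
      refine h6.trans (h2.trans ?_)
      gcongr
    have h8 : 1 ≤ A₂ * pw w n N := by
      rw [Real.exp_neg, inv_le_iff_one_le_mul₀ (Real.exp_pos _)] at h7
      rw [hA₂]
      linarith
    have : 0 ≤ A₁ * pw w n N := by positivity
    linarith

lemma cfact_pos {c : ℕ → ℝ} (hcpos : ∀ n : ℕ, 0 < n → 0 < c n) (k : ℕ) : 0 < cfact c k := by
  induction k with
  | zero => simp [cfact]
  | succ k ih => exact mul_pos ih (hcpos _ (Nat.succ_pos k))

lemma coeff_prod_tsum {ι : Type*} [DecidableEq ι] (Λ : Finset ι) (N : ℕ)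
    (F : ι → PowerSeries ℝ) :
    ∑' η : ι → ℕ, Set.indicator {η : ι → ℕ | (∀ x, x ∉ Λ → η x = 0) ∧ (∑ x ∈ Λ, η x) = N}
      (fun η => ∏ x ∈ Λ, PowerSeries.coeff (η x) (F x)) η
      = PowerSeries.coeff N (∏ x ∈ Λ, F x) := by
  rw [PowerSeries.coeff_prod, tsum_eq_sum (s := Finset.piAntidiag Λ N)]
  · symm
    apply Finset.sum_bij (fun (l : ι →₀ ℕ) _ => (l : ι → ℕ))
    · intro l hl
      rw [Finset.mem_finsuppAntidiag] at hl
      rw [Finset.mem_piAntidiag]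
      exact ⟨hl.1, fun i hi => hl.2 (Finsupp.mem_support_iff.mpr hi)⟩
    · intro l _ l' _ h
      exact DFunLike.coe_injective h
    · intro η hη
      rw [Finset.mem_piAntidiag] at hη
      refine ⟨Finsupp.onFinset Λ η hη.2, ?_, rfl⟩
      rw [Finset.mem_finsuppAntidiag]
      exact ⟨hη.1, Finsupp.support_onFinset_subset⟩
    · intro l hl
      rw [Finset.mem_finsuppAntidiag] at hl
      rw [Set.indicator_of_mem]
      refine ⟨fun x hx => ?_, hl.1⟩
      by_contra hne
      exact hx (hl.2 (Finsupp.mem_support_iff.mpr hne))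
  · intro η hη
    apply Set.indicator_of_notMem
    rintro ⟨h1, h2⟩
    apply hη
    rw [Finset.mem_piAntidiag]
    refine ⟨h2, fun i hi => ?_⟩
    by_contra hne
    exact hi (h1 i hne)

/-- The one-site grand canonical weights. -/
def gcw (c : ℕ → ℝ) (α : ℝ) (k : ℕ) : ℝ := (α ^ k / cfact c k) / Zfun c α

lemma gcw_site {c : ℕ → ℝ} (hcpos : ∀ n : ℕ, 0 < n → 0 < c n) {c₁ : ℝ} (hc₁ : 0 < c₁)
    (hcl : ∀ k : ℕ, c₁ * k ≤ c k) {α : ℝ} (hα : 0 < α) :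
    0 < Zfun c α ∧ ∃ M, Site c α (meanGC c α) M (gcw c α) := by
  have hv : ∀ k, 0 < α ^ k / cfact c k := fun k => div_pos (pow_pos hα k) (cfact_pos hcpos k)
  have hrec : ∀ k, c (k + 1) * (α ^ (k + 1) / cfact c (k + 1)) = α * (α ^ k / cfact c k) := by
    intro k
    have h1 := cfact_pos hcpos k
    have h2 := hcpos (k + 1) (Nat.succ_pos k)
    simp only [cfact]
    field_simp
    ring
  have hs := v_summable hα hc₁ hcl hv hrec
  have hs0 : Summable (fun k : ℕ => α ^ k / cfact c k) := by simpa using hs 0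
  have hZ : 0 < Zfun c α := hs0.tsum_pos (fun k => (hv k).le) 0 (hv 0)
  refine ⟨hZ, (∑' k : ℕ, (k : ℝ) ^ 2 * (α ^ k / cfact c k)) / Zfun c α, ?_, ?_, ?_, ?_, ?_⟩
  · exact fun k => div_pos (hv k) hZ
  · intro k
    unfold gcw
    rw [← mul_div_assoc, hrec k, mul_div_assoc]
  · exact hs_congr (hs0.hasSum.div_const (Zfun c α)) (fun k => rfl) (div_self hZ.ne').symm
  · have hs1 : Summable (fun k : ℕ => (k : ℝ) * α ^ k / cfact c k) := by
      simpa [mul_div_assoc] using hs 1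
    refine hs_congr (hs1.hasSum.div_const (Zfun c α)) (fun k => ?_) rfl
    unfold gcw
    ring
  · refine hs_congr ((hs 2).hasSum.div_const (Zfun c α)) (fun k => ?_) rfl
    unfold gcw
    ring

lemma prod_gcw {ι : Type*} {c : ℕ → ℝ} {α : ℝ} (hα : 0 < α) (hZ : 0 < Zfun c α) (Λ : Finset ι)
    {N : ℕ} {η : ι → ℕ} (h : ∑ x ∈ Λ, η x = N) :
    ∏ x ∈ Λ, (cfact c (η x))⁻¹
      = Zfun c α ^ Λ.card / α ^ N * ∏ x ∈ Λ, gcw c α (η x) := by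
  have h1 : ∏ x ∈ Λ, gcw c α (η x)
      = α ^ N * (∏ x ∈ Λ, (cfact c (η x))⁻¹) / Zfun c α ^ Λ.card := by
    unfold gcw
    rw [Finset.prod_div_distrib, Finset.prod_const]
    simp only [div_eq_mul_inv]
    rw [Finset.prod_mul_distrib, Finset.prod_pow_eq_pow_sum, h]
  rw [h1]
  have := hα.ne'
  have := hZ.ne'
  field_simp

lemma denom_eq (d : ℕ) {c : ℕ → ℝ} {α : ℝ} (hα : 0 < α) (hZ : 0 < Zfun c α)
    (Λ : Finset (Fin d → ℤ)) (N : ℕ) :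
    ∑' η : (Fin d → ℤ) → ℕ, nuWd d c Λ N η
      = Zfun c α ^ Λ.card / α ^ N *
        PowerSeries.coeff N ((PowerSeries.mk (gcw c α)) ^ Λ.card) := by
  rw [← Finset.prod_const (PowerSeries.mk (gcw c α)), ← coeff_prod_tsum, ← tsum_mul_left]
  apply tsum_congr
  intro η
  unfold nuWd
  by_cases hη : η ∈ {η : (Fin d → ℤ) → ℕ | (∀ x, x ∉ Λ → η x = 0) ∧ (∑ x ∈ Λ, η x) = N}
  · rw [Set.indicator_of_mem hη, Set.indicator_of_mem hη, prod_gcw hα hZ Λ hη.2]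
    simp only [PowerSeries.coeff_mk]
  · rw [Set.indicator_of_notMem hη, Set.indicator_of_notMem hη, mul_zero]

lemma numer_eq (d : ℕ) {c : ℕ → ℝ} {α : ℝ} (hα : 0 < α) (hZ : 0 < Zfun c α)
    (Λ' Λ : Finset (Fin d → ℤ)) (hsub : Λ' ⊆ Λ) (N : ℕ) (σ : (Fin d → ℤ) → ℕ) :
    ∑' η : (Fin d → ℤ) → ℕ, nuWd d c Λ N η *
        (Set.indicator {η : (Fin d → ℤ) → ℕ | ∀ x ∈ Λ', η x = σ x} (fun _ => (1 : ℝ))) η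
      = Zfun c α ^ Λ.card / α ^ N * ((∏ x ∈ Λ', gcw c α (σ x)) *
        (if ∑ x ∈ Λ', σ x ≤ N then PowerSeries.coeff (N - ∑ x ∈ Λ', σ x)
          ((PowerSeries.mk (gcw c α)) ^ (Λ \ Λ').card) else 0)) := by
  set F : (Fin d → ℤ) → PowerSeries ℝ := fun x =>
    if x ∈ Λ' then PowerSeries.C (gcw c α (σ x)) * PowerSeries.X ^ (σ x)
      else PowerSeries.mk (gcw c α) with hF
  have hprod : ∏ x ∈ Λ, F x = PowerSeries.C (∏ x ∈ Λ', gcw c α (σ x)) *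
      (PowerSeries.X ^ (∑ x ∈ Λ', σ x) * (PowerSeries.mk (gcw c α)) ^ (Λ \ Λ').card) := by
    rw [← Finset.prod_sdiff hsub]
    have h1 : ∏ x ∈ Λ \ Λ', F x = (PowerSeries.mk (gcw c α)) ^ (Λ \ Λ').card := by
      rw [← Finset.prod_const]
      apply Finset.prod_congr rfl
      intro x hx
      simp only [hF, (Finset.mem_sdiff.mp hx).2, if_false]
    have h2 : ∏ x ∈ Λ', F x = PowerSeries.C (∏ x ∈ Λ', gcw c α (σ x)) *
        PowerSeries.X ^ (∑ x ∈ Λ', σ x) := by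
      rw [map_prod, ← Finset.prod_pow_eq_pow_sum, ← Finset.prod_mul_distrib]
      apply Finset.prod_congr rfl
      intro x hx
      simp only [hF, hx, if_true]
    rw [h1, h2]
    ring
  rw [← PowerSeries.coeff_X_pow_mul', ← PowerSeries.coeff_C_mul, ← hprod, ← coeff_prod_tsum,
    ← tsum_mul_left]
  apply tsum_congr
  intro η
  unfold nuWd
  by_cases hη : η ∈ {η : (Fin d → ℤ) → ℕ | (∀ x, x ∉ Λ → η x = 0) ∧ (∑ x ∈ Λ, η x) = N}
  · rw [Set.indicator_of_mem hη, Set.indicator_of_mem hη, prod_gcw hα hZ Λ hη.2]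
    by_cases hσ : ∀ x ∈ Λ', η x = σ x
    · rw [Set.indicator_of_mem (by exact hσ), mul_one]
      congr 1
      apply Finset.prod_congr rfl
      intro x _
      by_cases hx : x ∈ Λ'
      · simp only [hF, hx, if_true, PowerSeries.coeff_C_mul_X_pow, hσ x hx]
      · simp only [hF, hx, if_false, PowerSeries.coeff_mk]
    · rw [Set.indicator_of_notMem (by exact hσ), mul_zero]
      push Not at hσ
      obtain ⟨x, hx, hne⟩ := hσ
      rw [Finset.prod_eq_zero (hsub hx), mul_zero]
      simp only [hF, hx, if_true, PowerSeries.coeff_C_mul_X_pow, hne, if_false]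
  · rw [Set.indicator_of_notMem hη, Set.indicator_of_notMem hη, mul_zero, zero_mul]


/-- Proposition 4.1: comparison between the canonical and grand canonical ensembles.
Here `α` is the fugacity `α(N/|Λ|)`, i.e. the positive solution of
`μ_α[η_x] = N/|Λ|`, and the right-hand side is
`A₀ μ_{N/|Λ|}[η_{Λ'} = σ_{Λ'}] = A₀ ∏_{x∈Λ'} α^{σ_x}/(Z(α) c(σ_x)!)`. -/
theorem statement15 (d : ℕ) (hd : 1 ≤ d)
    (c : ℕ → ℝ) (a₁ a₂ : ℝ) (k₀ : ℕ)
    (hc0 : c 0 = 0) (hcpos : ∀ n : ℕ, 0 < n → 0 < c n)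
    (hLG : ∀ k : ℕ, |c (k + 1) - c k| ≤ a₁)
    (hk₀ : 0 < k₀) (ha₂ : 0 < a₂)
    (hM : ∀ j k : ℕ, j + k₀ ≤ k → a₂ ≤ c k - c j)
    (δ₀ : ℝ) (hδ₀0 : 0 < δ₀) (hδ₀1 : δ₀ < 1) :
    ∃ (v₀ : ℕ) (A₀ : ℝ), 0 < A₀ ∧
      ∀ (Λ' Λ : Finset (Fin d → ℤ)), Λ' ⊆ Λ →
        v₀ ≤ Λ.card → (Λ'.card : ℝ) ≤ δ₀ * (Λ.card : ℝ) →
        ∀ N : ℕ, 1 ≤ N →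
        ∀ α : ℝ, 0 < α → meanGC c α = (N : ℝ) / (Λ.card : ℝ) →
        ∀ σ : (Fin d → ℤ) → ℕ,
          wEd d (nuWd d c Λ N)
              (Set.indicator {η : (Fin d → ℤ) → ℕ | ∀ x ∈ Λ', η x = σ x} (fun _ => (1 : ℝ)))
            ≤ A₀ * ∏ x ∈ Λ', (α ^ σ x / cfact c (σ x)) / Zfun c α := by
  obtain ⟨c₁, hc₁, hcl⟩ := c_linear_lower hc0 hcpos hk₀ ha₂ hM
  obtain ⟨A₀, hA₀, hcore⟩ := core hc0 hLG hk₀ ha₂ hM hc₁ hcl hδ₀1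
  refine ⟨1, A₀, hA₀, ?_⟩
  intro Λ' Λ hsub hv hcard N hN α hα hmean σ
  obtain ⟨hZ, M, hsite⟩ := gcw_site hcpos hc₁ hcl hα
  have hcs : (Λ \ Λ').card + Λ'.card = Λ.card := Finset.card_sdiff_add_card_eq_card hsub
  have hcs' : ((Λ \ Λ').card : ℝ) + Λ'.card = Λ.card := by exact_mod_cast hcs
  have hΛpos : (0 : ℝ) < Λ.card := by exact_mod_cast hv
  have hmpos : 0 < (Λ \ Λ').card := by
    have : (0 : ℝ) < (Λ \ Λ').card := by nlinarith
    exact_mod_cast this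
  obtain ⟨n, hn⟩ : ∃ n, Λ.card = n + 1 := ⟨Λ.card - 1, by omega⟩
  obtain ⟨m, hm⟩ : ∃ m, (Λ \ Λ').card = m + 1 := ⟨(Λ \ Λ').card - 1, by omega⟩
  have hn' : (Λ.card : ℝ) = (n : ℝ) + 1 := by rw [hn]; push_cast; ring
  have hm' : ((Λ \ Λ').card : ℝ) = (m : ℝ) + 1 := by rw [hm]; push_cast; ring
  have hc := hcore α _ M _ hα hsite n m N (by rw [← hn', ← hm']; linarith) hN
    (by rw [hmean, ← hn']; field_simp)
  have hpN := pw_pos hsite.pos n N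
  unfold wEd
  rw [numer_eq d hα hZ Λ' Λ hsub N σ, denom_eq d hα hZ Λ N, hn, hm, ← pw_coeff, ← pw_coeff]
  rw [mul_div_mul_left _ _ (by positivity), div_le_iff₀ hpN]
  change (∏ x ∈ Λ', gcw c α (σ x)) * _ ≤ A₀ * (∏ x ∈ Λ', gcw c α (σ x)) * _
  have hP : 0 ≤ ∏ x ∈ Λ', gcw c α (σ x) := Finset.prod_nonneg (fun x _ => (hsite.pos _).le)
  have hif : (if ∑ x ∈ Λ', σ x ≤ N then pw (gcw c α) m (N - ∑ x ∈ Λ', σ x) else 0)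
      ≤ A₀ * pw (gcw c α) n N := by
    split_ifs
    · exact hc _
    · positivity
  have := mul_le_mul_of_nonneg_left hif hP
  linarith
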